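/- Let 𝒰 = U_𝒜(v_1, v_2) be a non-degenerate (3,2)-Ulam set with v_1 ≠ 0 and v_2 ≠ 0. Then: (1) v_1 > 1 and v_2 > 1, and at least one of v_1, v_2 is even; (2) 𝒜 ∩ W_{(v_1,v_2)} = 𝒰 ∩ W_{(v_1,v_2)}; (3) every point (m,n) ∈ ℤ_{≥0}² with m ≥ 1 and n ≥ 1 can be written as the sum of two distinct elements of 𝒰. -/

import Mathlib

/-- The norm `|(x,y)| = x + y` on `ℤ_{≥0}²`. -/
def vnorm (v : ℕ × ℕ) : ℕ := v.1 + v.2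

/-- `v` has a representation as a sum of two distinct elements of `S`. -/
def HasRep (S : Set (ℕ × ℕ)) (v : ℕ × ℕ) : Prop :=
  ∃ a b : ℕ × ℕ, a ∈ S ∧ b ∈ S ∧ a ≠ b ∧ a + b = v

/-- `v` can be written as a sum of two distinct elements of `S` in exactly one way
(as an unordered pair). -/
def UniqueRep (S : Set (ℕ × ℕ)) (v : ℕ × ℕ) : Prop :=
  ∃ a b : ℕ × ℕ, a ∈ S ∧ b ∈ S ∧ a ≠ b ∧ a + b = v ∧
    ∀ c d : ℕ × ℕ, c ∈ S → d ∈ S → c ≠ d → c + d = v →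
      (c = a ∧ d = b) ∨ (c = b ∧ d = a)

/-- One step of the Ulam process: adjoin all new vectors of minimal norm among those
having exactly one representation as a sum of two distinct elements of `S`. -/
def ulamStep (S : Set (ℕ × ℕ)) : Set (ℕ × ℕ) :=
  S ∪ {v | v ∉ S ∧ UniqueRep S v ∧
    ∀ w : ℕ × ℕ, w ∉ S → UniqueRep S w → vnorm v ≤ vnorm w}

/-- The stages of the Ulam process started from the set `init`. -/
def ulamStage (init : Set (ℕ × ℕ)) : ℕ → Set (ℕ × ℕ)
  | 0 => init
  | j + 1 => ulamStep (ulamStage init j)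

/-- The Ulam set generated by the initial vectors `init`. -/
def ulamSet2 (init : Set (ℕ × ℕ)) : Set (ℕ × ℕ) := ⋃ j, ulamStage init j

/-- Non-degeneracy: no initial vector belongs to the Ulam set generated by the
remaining initial vectors. -/
def NonDegenerate (l : List (ℕ × ℕ)) : Prop :=
  ∀ i : Fin l.length, l.get i ∉ ulamSet2 {w | ∃ j : Fin l.length, j ≠ i ∧ l.get j = w}

/-- The region `W_{(v₁,v₂)}`. -/
def W (v : ℕ × ℕ) : Set (ℕ × ℕ) := {p | p.1 < v.1 ∨ p.2 < v.2}

theorem UniqueRep.congr {S T : Set (ℕ × ℕ)} {v : ℕ × ℕ} (hS : 0 ∉ S) (hT : 0 ∉ T)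
    (h : ∀ p ≤ v, vnorm p < vnorm v → (p ∈ S ↔ p ∈ T)) (hv : UniqueRep S v) :
    UniqueRep T v := by
  have key : ∀ R : Set (ℕ × ℕ), 0 ∉ R → ∀ a b : ℕ × ℕ, a ∈ R → b ∈ R → a + b = v →
      (a ≤ v ∧ vnorm a < vnorm v) ∧ (b ≤ v ∧ vnorm b < vnorm v) := by
    rintro R hR ⟨a₁, a₂⟩ ⟨b₁, b₂⟩ ha hb rfl
    have ha0 : ¬(a₁ = 0 ∧ a₂ = 0) := by rintro ⟨rfl, rfl⟩; exact hR ha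
    have hb0 : ¬(b₁ = 0 ∧ b₂ = 0) := by rintro ⟨rfl, rfl⟩; exact hR hb
    simp only [vnorm, Prod.mk_add_mk, Prod.mk_le_mk]
    omega
  obtain ⟨a, b, ha, hb, hne, hab, huniq⟩ := hv
  obtain ⟨⟨ha₁, ha₂⟩, hb₁, hb₂⟩ := key S hS a b ha hb hab
  refine ⟨a, b, (h a ha₁ ha₂).1 ha, (h b hb₁ hb₂).1 hb, hne, hab, fun c d hc hd hcd hs => ?_⟩
  obtain ⟨⟨hc₁, hc₂⟩, hd₁, hd₂⟩ := key T hT c d hc hd hs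
  exact huniq c d ((h c hc₁ hc₂).2 hc) ((h d hd₁ hd₂).2 hd) hcd hs

theorem not_uniqueRep_zero (S : Set (ℕ × ℕ)) : ¬UniqueRep S 0 := by
  rintro ⟨⟨a₁, a₂⟩, ⟨b₁, b₂⟩, -, -, hne, hab, -⟩
  simp only [Prod.ext_iff, Prod.mk_add_mk, Prod.fst_zero, Prod.snd_zero] at hab
  exact hne (by ext <;> simp only <;> omega)

theorem ulamStage_mono (init : Set (ℕ × ℕ)) : Monotone (ulamStage init) :=
  monotone_nat_of_le_succ fun _ => Set.subset_union_left

theorem zero_notMem_ulamStage {init : Set (ℕ × ℕ)} (h0 : 0 ∉ init) (j : ℕ) :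
    0 ∉ ulamStage init j := by
  induction j with
  | zero => exact h0
  | succ j ih =>
    rintro (h | ⟨-, h, -⟩)
    · exact ih h
    · exact not_uniqueRep_zero _ h

theorem mem_ulamSet2 {init : Set (ℕ × ℕ)} {v : ℕ × ℕ} :
    v ∈ ulamSet2 init ↔ ∃ j, v ∈ ulamStage init j := Set.mem_iUnion

theorem zero_notMem_ulamSet2 {init : Set (ℕ × ℕ)} (h0 : 0 ∉ init) : 0 ∉ ulamSet2 init := by
  rw [mem_ulamSet2]
  rintro ⟨j, hj⟩
  exact zero_notMem_ulamStage h0 j hj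

/-- No stage after `j` adds a vector of norm less than the minimal norm of the candidates at
stage `j`. -/
theorem le_vnorm_of_le_candidates {init : Set (ℕ × ℕ)} (h0 : 0 ∉ init) {j N : ℕ}
    (hN : ∀ w, w ∉ ulamStage init j → UniqueRep (ulamStage init j) w → N ≤ vnorm w)
    {k : ℕ} (hjk : j ≤ k) :
    (∀ w, w ∉ ulamStage init k → UniqueRep (ulamStage init k) w → N ≤ vnorm w) ∧
      ∀ w ∈ ulamStage init k, w ∉ ulamStage init j → N ≤ vnorm w := by
  induction k, hjk using Nat.le_induction with
  | base => exact ⟨hN, fun w hw hw' => absurd hw hw'⟩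
  | succ k hjk ih =>
    refine ⟨fun w hw hu => ?_, ?_⟩
    · by_contra! hlt
      have hwk : w ∉ ulamStage init k := fun h => hw (ulamStage_mono init k.le_succ h)
      refine hlt.not_ge (ih.1 w hwk (hu.congr (zero_notMem_ulamStage h0 _)
        (zero_notMem_ulamStage h0 _) fun p _ hp => ⟨?_, fun h => ulamStage_mono init k.le_succ h⟩))
      rintro (h | ⟨hp₁, hp₂, -⟩)
      · exact h
      · exact absurd (ih.1 p hp₁ hp₂) (by omega)
    · rintro w (h | ⟨hw₁, hw₂, -⟩) hwj
      · exact ih.2 w h hwj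
      · exact ih.1 w hw₁ hw₂

theorem mem_ulamSet2_iff {init : Set (ℕ × ℕ)} (h0 : 0 ∉ init) (v : ℕ × ℕ) :
    v ∈ ulamSet2 init ↔ v ∈ init ∨ UniqueRep (ulamSet2 init) v := by
  constructor
  · rw [mem_ulamSet2]
    rintro ⟨j, hj⟩
    induction j with
    | zero => exact Or.inl hj
    | succ j ih =>
      obtain h | ⟨-, hu, hmin⟩ := hj
      · exact ih h
      refine Or.inr (hu.congr (zero_notMem_ulamStage h0 _) (zero_notMem_ulamSet2 h0)
        fun p _ hp => ⟨fun h => mem_ulamSet2.2 ⟨j, h⟩, fun h => ?_⟩)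
      obtain ⟨k, hk⟩ := mem_ulamSet2.1 h
      by_contra hpj
      exact absurd ((le_vnorm_of_le_candidates h0 hmin (le_max_left j k)).2 p
        (ulamStage_mono init (le_max_right j k) hk) hpj) (by omega)
  · rintro (h | hu)
    · exact mem_ulamSet2.2 ⟨0, h⟩
    by_contra hv
    have hJ : ∃ J, ∀ p, vnorm p ≤ vnorm v → p ∈ ulamSet2 init → p ∈ ulamStage init J := by
      have : ∀ p, ∃ j, p ∈ ulamSet2 init → p ∈ ulamStage init j := fun p => by
        by_cases hp : p ∈ ulamSet2 init
        · obtain ⟨j, hj⟩ := mem_ulamSet2.1 hp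
          exact ⟨j, fun _ => hj⟩
        · exact ⟨0, fun h => absurd h hp⟩
      choose f hf using this
      refine ⟨(Finset.Iic (vnorm v, vnorm v)).sup f, fun p hp hpU =>
        ulamStage_mono init (Finset.le_sup (Finset.mem_Iic.2 ?_)) (hf p hpU)⟩
      simp only [vnorm] at hp
      exact ⟨by simp only [vnorm]; omega, by simp only [vnorm]; omega⟩
    obtain ⟨J, hJ⟩ := hJ
    have hsub : ulamStage init J ⊆ ulamSet2 init := fun p hp => mem_ulamSet2.2 ⟨J, hp⟩
    have huJ : UniqueRep (ulamStage init J) v :=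
      hu.congr (zero_notMem_ulamSet2 h0) (zero_notMem_ulamStage h0 _)
        fun p _ hp => ⟨hJ p hp.le, fun h => hsub h⟩
    obtain ⟨w, ⟨hwJ, hwu⟩, hmin⟩ := exists_minimalFor_of_wellFoundedLT
      (fun w => w ∉ ulamStage init J ∧ UniqueRep (ulamStage init J) w) vnorm
      ⟨v, fun h => hv (hsub h), huJ⟩
    have hmin' : ∀ u, u ∉ ulamStage init J → UniqueRep (ulamStage init J) u →
        vnorm w ≤ vnorm u := fun u hu₁ hu₂ =>
      (le_total (vnorm w) (vnorm u)).elim id fun h => hmin ⟨hu₁, hu₂⟩ h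
    exact hwJ (hJ w (hmin' v (fun h => hv (hsub h)) huJ)
      (mem_ulamSet2.2 ⟨J + 1, Or.inr ⟨hwJ, hwu, hmin'⟩⟩))

/-- A lower set of vectors on which two sets obey the same Ulam recursion is one on which
they agree. -/
theorem mem_iff_mem_of_recursion {S T D : Set (ℕ × ℕ)} {I J : Set (ℕ × ℕ)} (hD : IsLowerSet D)
    (hS0 : 0 ∉ S) (hT0 : 0 ∉ T) (hIJ : ∀ v ∈ D, v ∈ I ↔ v ∈ J)
    (hS : ∀ v, v ∈ S ↔ v ∈ I ∨ UniqueRep S v) (hT : ∀ v, v ∈ T ↔ v ∈ J ∨ UniqueRep T v)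
    (v : ℕ × ℕ) (hv : v ∈ D) : v ∈ S ↔ v ∈ T := by
  induction hn : vnorm v using Nat.strong_induction_on generalizing v with
  | _ n ih =>
    subst hn
    have h : ∀ p ≤ v, vnorm p < vnorm v → (p ∈ S ↔ p ∈ T) := fun p hpv hp =>
      ih _ hp p (hD hpv hv) rfl
    rw [hS, hT, hIJ v hv]
    exact or_congr_right ⟨fun hu => hu.congr hS0 hT0 h,
      fun hu => hu.congr hT0 hS0 fun p h₁ h₂ => (h p h₁ h₂).symm⟩

/-- The explicit form of the Ulam set generated by `(1,0)` and `(0,1)`. -/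
def unitUlamSet : Set (ℕ × ℕ) :=
  {p | (p.1 = 1 ∧ p.2 = 0) ∨ (p.1 = 0 ∧ p.2 = 1) ∨
    (1 ≤ p.1 ∧ 1 ≤ p.2 ∧ (p.1 = 1 ∨ p.2 = 1 ∨ (p.1 % 2 = 1 ∧ p.2 % 2 = 1)))}

theorem mk_mem_unitUlamSet {m n : ℕ} : (m, n) ∈ unitUlamSet ↔ (m = 1 ∧ n = 0) ∨
    (m = 0 ∧ n = 1) ∨ (1 ≤ m ∧ 1 ≤ n ∧ (m = 1 ∨ n = 1 ∨ (m % 2 = 1 ∧ n % 2 = 1))) := Iff.rfl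

theorem not_uniqueRep_of_two {S : Set (ℕ × ℕ)} {v a b c d : ℕ × ℕ} (ha : a ∈ S) (hb : b ∈ S)
    (hc : c ∈ S) (hd : d ∈ S) (hab : a ≠ b) (hcd : c ≠ d) (hs : a + b = v) (ht : c + d = v)
    (h₁ : a ≠ c) (h₂ : a ≠ d) : ¬UniqueRep S v := by
  rintro ⟨x, y, -, -, -, -, h⟩
  have := h a b ha hb hab hs
  have := h c d hc hd hcd ht
  grind

theorem uniqueRep_unitUlamSet_of_mem {m n : ℕ} (hm : 1 ≤ m) (hn : 1 ≤ n)
    (h : (m, n) ∈ unitUlamSet) : UniqueRep unitUlamSet (m, n) := by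
  simp only [mk_mem_unitUlamSet] at h
  by_cases hm1 : m = 1
  · refine ⟨(1, n - 1), (0, 1), ?_, ?_, ?_, ?_, ?_⟩ <;>
      simp only [mk_mem_unitUlamSet, Prod.forall, Prod.mk_add_mk, Prod.mk.injEq,
        ne_eq, true_and, and_true,
        true_or, or_true] <;> omega
  by_cases hn1 : n = 1
  · refine ⟨(m - 1, 1), (1, 0), ?_, ?_, ?_, ?_, ?_⟩ <;>
      simp only [mk_mem_unitUlamSet, Prod.forall, Prod.mk_add_mk, Prod.mk.injEq,
        ne_eq, true_and, and_true,
        true_or, or_true] <;> omega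
  refine ⟨(m - 1, 1), (1, n - 1), ?_, ?_, ?_, ?_, ?_⟩ <;>
    simp only [mk_mem_unitUlamSet, Prod.forall, Prod.mk_add_mk, Prod.mk.injEq,
      ne_eq, true_and, and_true,
        true_or, or_true] <;> omega

theorem mem_unitUlamSet_of_uniqueRep {m n : ℕ} (hu : UniqueRep unitUlamSet (m, n)) :
    (m, n) ∈ unitUlamSet := by
  by_contra h
  simp only [mk_mem_unitUlamSet] at h
  by_cases h0 : m = 0 ∨ n = 0
  · obtain ⟨⟨a₁, a₂⟩, ⟨b₁, b₂⟩, ha, hb, hne, hab, -⟩ := hu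
    simp only [mk_mem_unitUlamSet, Prod.mk_add_mk, Prod.mk.injEq, ne_eq] at *
    omega
  revert hu
  by_cases h22 : m = 2 ∧ n = 2
  · apply not_uniqueRep_of_two (a := (2, 1)) (b := (0, 1)) (c := (1, 2)) (d := (1, 0)) <;>
      simp only [mk_mem_unitUlamSet, Prod.mk_add_mk, Prod.mk.injEq, ne_eq, true_and, and_true,
        true_or, or_true] <;> omega
  by_cases hm : m % 2 = 0 ∧ (m = 2 ∨ n % 2 = 1)
  · apply not_uniqueRep_of_two (a := (m - 1, n)) (b := (1, 0)) (c := (m - 1, 1))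
      (d := (1, n - 1)) <;>
      simp only [mk_mem_unitUlamSet, Prod.mk_add_mk, Prod.mk.injEq, ne_eq, true_and, and_true,
        true_or, or_true] <;> omega
  by_cases hn : n % 2 = 0 ∧ (n = 2 ∨ m % 2 = 1)
  · apply not_uniqueRep_of_two (a := (m, n - 1)) (b := (0, 1)) (c := (m - 1, 1))
      (d := (1, n - 1)) <;>
      simp only [mk_mem_unitUlamSet, Prod.mk_add_mk, Prod.mk.injEq, ne_eq, true_and, and_true,
        true_or, or_true] <;> omega
  apply not_uniqueRep_of_two (a := (m - 1, n - 1)) (b := (1, 1)) (c := (m - 1, 1))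
    (d := (1, n - 1)) <;>
    simp only [mk_mem_unitUlamSet, Prod.mk_add_mk, Prod.mk.injEq, ne_eq, true_and, and_true,
        true_or, or_true] <;> omega

theorem mem_unitUlamSet_iff (v : ℕ × ℕ) :
    v ∈ unitUlamSet ↔ v ∈ ({(1, 0), (0, 1)} : Set (ℕ × ℕ)) ∨ UniqueRep unitUlamSet v := by
  obtain ⟨m, n⟩ := v
  refine ⟨fun h => ?_, ?_⟩
  · by_cases hmn : 1 ≤ m ∧ 1 ≤ n
    · exact Or.inr (uniqueRep_unitUlamSet_of_mem hmn.1 hmn.2 h)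
    · simp only [mk_mem_unitUlamSet, Set.mem_insert_iff, Set.mem_singleton_iff,
        Prod.mk.injEq] at *
      omega
  · rintro (h | h)
    · simp only [mk_mem_unitUlamSet, Set.mem_insert_iff, Set.mem_singleton_iff,
        Prod.mk.injEq] at *
      omega
    · exact mem_unitUlamSet_of_uniqueRep h

theorem ulamSet2_unit : ulamSet2 {(1, 0), (0, 1)} = unitUlamSet := by
  have h0 : (0 : ℕ × ℕ) ∉ ({(1, 0), (0, 1)} : Set (ℕ × ℕ)) := by simp [Prod.ext_iff]
  ext v
  exact mem_iff_mem_of_recursion isLowerSet_univ (zero_notMem_ulamSet2 h0)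
    (by simp [unitUlamSet]) (fun _ _ => Iff.rfl) (mem_ulamSet2_iff h0) mem_unitUlamSet_iff v
    (Set.mem_univ v)

/-- basic structure of non-degenerate `(3,2)`-Ulam sets
`𝒰 = U_𝒜(v₁,v₂)` with `v₁, v₂ ≠ 0`. -/
theorem stmt16 (v₁ v₂ : ℕ) (hv₁ : v₁ ≠ 0) (hv₂ : v₂ ≠ 0)
    (hnd : NonDegenerate [(1, 0), (0, 1), (v₁, v₂)]) :
    (1 < v₁ ∧ 1 < v₂ ∧ (Even v₁ ∨ Even v₂)) ∧
    ulamSet2 {(1, 0), (0, 1)} ∩ W (v₁, v₂) =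
      ulamSet2 {(1, 0), (0, 1), (v₁, v₂)} ∩ W (v₁, v₂) ∧
    (∀ m n : ℕ, 1 ≤ m → 1 ≤ n →
      HasRep (ulamSet2 {(1, 0), (0, 1), (v₁, v₂)}) (m, n)) := by
  have hv : (v₁, v₂) ∉ unitUlamSet := by
    rw [← ulamSet2_unit]
    have h : {w | ∃ j : Fin 3, j ≠ 2 ∧ [(1, 0), (0, 1), (v₁, v₂)].get j = w} =
        ({(1, 0), (0, 1)} : Set (ℕ × ℕ)) := by
      ext w
      simp [Fin.exists_fin_succ, eq_comm, Fin.ext_iff]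
    exact h ▸ hnd (2 : Fin 3)
  simp only [mk_mem_unitUlamSet] at hv
  have hpar : 1 < v₁ ∧ 1 < v₂ ∧ (Even v₁ ∨ Even v₂) := by
    simp only [Nat.even_iff]
    omega
  have h0 : (0 : ℕ × ℕ) ∉ ({(1, 0), (0, 1)} : Set (ℕ × ℕ)) := by simp [Prod.ext_iff]
  have h0' : (0 : ℕ × ℕ) ∉ ({(1, 0), (0, 1), (v₁, v₂)} : Set (ℕ × ℕ)) := by
    simp [Prod.ext_iff, hv₁.symm]
  have hW : ∀ p ∈ W (v₁, v₂), p ∈ ulamSet2 {(1, 0), (0, 1)} ↔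
      p ∈ ulamSet2 {(1, 0), (0, 1), (v₁, v₂)} := by
    refine mem_iff_mem_of_recursion ?_ (zero_notMem_ulamSet2 h0) (zero_notMem_ulamSet2 h0') ?_
      (mem_ulamSet2_iff h0) (mem_ulamSet2_iff h0')
    · rintro ⟨a, b⟩ ⟨c, d⟩ ⟨h₁, h₂⟩ h
      simp only [W, Set.mem_ofPred_eq] at *
      omega
    · rintro ⟨a, b⟩ h
      simp only [W, Set.mem_ofPred_eq, Set.mem_insert_iff, Set.mem_singleton_iff,
        Prod.mk.injEq] at *
      omega
  have hmem : ∀ a b : ℕ, (a ≤ 1 ∨ b ≤ 1) ∧ (a, b) ∈ unitUlamSet →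
      (a, b) ∈ ulamSet2 {(1, 0), (0, 1), (v₁, v₂)} := fun a b ⟨hab, h⟩ => by
    refine (hW (a, b) ?_).1 (ulamSet2_unit ▸ h)
    simp only [W, Set.mem_ofPred_eq]
    omega
  refine ⟨hpar, ?_, fun m n hm hn => ?_⟩
  · ext p
    exact and_congr_left (hW p)
  · by_cases hm1 : m = 1
    · refine ⟨(1, n - 1), (0, 1), hmem _ _ ?_, hmem _ _ ?_, ?_, ?_⟩ <;>
        simp only [mk_mem_unitUlamSet, Prod.mk_add_mk, Prod.mk.injEq, ne_eq, true_and, and_true,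
        true_or, or_true] <;> omega
    by_cases hn1 : n = 1 ∨ n = 2 ∧ m = 2
    · refine ⟨(m - 1, n), (1, 0), hmem _ _ ?_, hmem _ _ ?_, ?_, ?_⟩ <;>
        simp only [mk_mem_unitUlamSet, Prod.mk_add_mk, Prod.mk.injEq, ne_eq, true_and, and_true,
        true_or] <;> omega
    refine ⟨(m - 1, 1), (1, n - 1), hmem _ _ ?_, hmem _ _ ?_, ?_, ?_⟩ <;>
      simp only [mk_mem_unitUlamSet, Prod.mk_add_mk, Prod.mk.injEq, ne_eq, true_and, and_true,
        true_or, or_true] <;> omega
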